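/- arXiv:1804.02917 — 2 statements merged into one kernel-verified Lean document; each statement's English description precedes it below -/
import Mathlib

section
/- For any pair of indices (i,j), if x i j = true and y i j = true then dist(ℓ_i, r'_j) = 3 in G(x,y). -/
/-- Vertices of the graph `G(x,y)`: four blocks of `s` vertices each
(`L`, `L'`, `R`, `R'`) plus two extra vertices `a` and `b`. -/
inductive Vtx (s : ℕ) : Type
  | L : Fin s → Vtx s
  | L' : Fin s → Vtx s
  | R : Fin s → Vtx s
  | R' : Fin s → Vtx s
  | a : Vtx s
  | b : Vtx s
  deriving DecidableEq

/-- The base (not yet symmetrized) relation describing the edges of `G(x,y)`. -/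
def baseRel {s : ℕ} (x y : Fin s → Fin s → Bool) : Vtx s → Vtx s → Prop
  | .L _, .L _ => True        -- L is a clique
  | .L' _, .L' _ => True      -- L' is a clique
  | .R _, .R _ => True        -- R is a clique
  | .R' _, .R' _ => True      -- R' is a clique
  | .L i, .R j => i = j       -- matching edges ℓ_i — r_i
  | .L' i, .R' j => i = j     -- matching edges ℓ'_i — r'_i
  | .a, .L _ => True          -- a joined to all of L
  | .a, .L' _ => True         -- a joined to all of L'
  | .b, .R _ => True          -- b joined to all of R
  | .b, .R' _ => True         -- b joined to all of R'
  | .a, .b => True            -- the edge {a, b}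
  | .L i, .L' j => x i j = false  -- input-dependent edges on Alice's side
  | .R i, .R' j => y i j = false  -- input-dependent edges on Bob's side
  | _, _ => False

/-- The graph `G(x,y)` from the proof of Theorem 14. -/
def Gxy {s : ℕ} (x y : Fin s → Fin s → Bool) : SimpleGraph (Vtx s) :=
  SimpleGraph.fromRel (baseRel x y)

/-- The set `U = L ∪ L' ∪ {a}`. -/
def Uset (s : ℕ) : Set (Vtx s) :=
  {w | (∃ i, w = .L i) ∨ (∃ i, w = .L' i) ∨ w = .a}

/-- The set `V = R ∪ R' ∪ {b}`. -/
def Vset (s : ℕ) : Set (Vtx s) :=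
  {w | (∃ i, w = .R i) ∨ (∃ i, w = .R' i) ∨ w = .b}

/-- The vertices `ℓ_i` and `r'_j` are not adjacent in `G(x,y)`. -/
lemma not_adj_L_R' {s : ℕ} (x y : Fin s → Fin s → Bool) (i j : Fin s) :
    ¬ (Gxy x y).Adj (.L i) (.R' j) := by
  simp [Gxy, baseRel]

/-- If `x i j` and `y i j` hold, then `ℓ_i` and `r'_j` have no common neighbour in `G(x,y)`. -/
lemma no_common_neighbor_L_R' {s : ℕ} {x y : Fin s → Fin s → Bool} {i j : Fin s}
    (hx : x i j = true) (hy : y i j = true) (w : Vtx s) (hiw : (Gxy x y).Adj (.L i) w) :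
    ¬ (Gxy x y).Adj w (.R' j) := by
  cases w <;> simp_all [Gxy, baseRel]; grind

/-- For any pair of indices `(i,j)`, if `x i j = true` and `y i j = true` then
the distance between `ℓ_i` and `r'_j` in `G(x,y)` is exactly 3. -/
theorem stmt_2 (s : ℕ) (hs : 1 ≤ s) (x y : Fin s → Fin s → Bool) (i j : Fin s)
    (hx : x i j = true) (hy : y i j = true) :
    (Gxy x y).dist (.L i) (.R' j) = 3 := by
  have hia : (Gxy x y).Adj (.L i) .a := by simp [Gxy, baseRel]
  have hab : (Gxy x y).Adj .a .b := by simp [Gxy, baseRel]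
  have hbj : (Gxy x y).Adj .b (.R' j) := by simp [Gxy, baseRel]
  let p : (Gxy x y).Walk (.L i) (.R' j) := .cons hia (.cons hab (.cons hbj .nil))
  refine le_antisymm (SimpleGraph.dist_le p) ?_
  obtain ⟨q, hq⟩ := p.reachable.exists_walk_length_eq_dist
  rw [← hq]
  match q with
  | .cons h .nil => exact absurd h (not_adj_L_R' x y i j)
  | .cons h (.cons hw .nil) => exact absurd hw (no_common_neighbor_L_R' hx hy _ h)
  | .cons _ (.cons _ (.cons _ _)) => simp only [SimpleGraph.Walk.length_cons]; omega
end

section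
/- If there exists a pair of indices (i,j) with x i j = true and y i j = true, then the diameter of G(x,y) is exactly 3: some pair of vertices is at distance exactly 3, and every pair of vertices is at distance at most 3. -/
/-- The hub of a vertex: `a` for the vertices of `U`, and `b` for the vertices of `V`. -/
def Vtx.hub {s : ℕ} : Vtx s → Vtx s
  | .L _ | .L' _ | .a => .a
  | .R _ | .R' _ | .b => .b

theorem Gxy_edist_hub_le_one {s : ℕ} (x y : Fin s → Fin s → Bool) (w : Vtx s) :
    (Gxy x y).edist w w.hub ≤ 1 := by
  rw [SimpleGraph.edist_le_one_iff_adj_or_eq]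
  cases w <;> simp [Gxy, baseRel, Vtx.hub]

theorem Gxy_edist_hub_hub_le_one {s : ℕ} (x y : Fin s → Fin s → Bool) (u v : Vtx s) :
    (Gxy x y).edist u.hub v.hub ≤ 1 := by
  rw [SimpleGraph.edist_le_one_iff_adj_or_eq]
  cases u <;> cases v <;> simp [Gxy, baseRel, Vtx.hub]

theorem Gxy_edist_le_three {s : ℕ} (x y : Fin s → Fin s → Bool) (u v : Vtx s) :
    (Gxy x y).edist u v ≤ 3 :=
  calc (Gxy x y).edist u v
      ≤ (Gxy x y).edist u u.hub + (Gxy x y).edist u.hub v := SimpleGraph.edist_triangle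
    _ ≤ (Gxy x y).edist u u.hub +
          ((Gxy x y).edist u.hub v.hub + (Gxy x y).edist v.hub v) := by
        gcongr
        exact SimpleGraph.edist_triangle
    _ ≤ 1 + (1 + 1) := by
        gcongr
        · exact Gxy_edist_hub_le_one x y u
        · exact Gxy_edist_hub_hub_le_one x y u v
        · rw [SimpleGraph.edist_comm]
          exact Gxy_edist_hub_le_one x y v
    _ = 3 := by norm_num

/-- When `x i j` and `y i j` are both true, every walk from `ℓ_i` to `r'_j` has length at
least `3`. -/
theorem Gxy_three_le_length {s : ℕ} {x y : Fin s → Fin s → Bool} {i j : Fin s}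
    (hx : x i j = true) (hy : y i j = true) (p : (Gxy x y).Walk (.L i) (.R' j)) :
    3 ≤ p.length := by
  rcases p with _ | ⟨h₁, _ | ⟨h₂, _ | ⟨h₃, p⟩⟩⟩
  · simp [Gxy, baseRel] at h₁
  · exfalso
    rename_i w
    cases w <;> simp_all [Gxy, baseRel]
  · simp

/-- If the inputs `x` and `y` intersect, then the diameter of `G(x,y)` is exactly 3:
some pair of vertices is at distance exactly 3, and every pair of vertices is at
distance at most 3. -/
theorem stmt_7 (s : ℕ) (hs : 1 ≤ s) (x y : Fin s → Fin s → Bool)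
    (hxy : ∃ i j, x i j = true ∧ y i j = true) :
    (∃ u v : Vtx s, (Gxy x y).dist u v = 3) ∧
    ∀ u v : Vtx s, (Gxy x y).dist u v ≤ 3 := by
  have hle (u v : Vtx s) : (Gxy x y).dist u v ≤ 3 :=
    ENat.toNat_le_of_le_natCast (Gxy_edist_le_three x y u v)
  obtain ⟨i, j, hx, hy⟩ := hxy
  refine ⟨⟨.L i, .R' j, (hle _ _).antisymm ?_⟩, hle⟩
  have hreach : (Gxy x y).Reachable (.L i) (.R' j) :=
    SimpleGraph.edist_ne_top_iff_reachable.mp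
      ((Gxy_edist_le_three x y _ _).trans_lt (ENat.natCast_lt_top 3)).ne
  obtain ⟨p, hp⟩ := hreach.exists_walk_length_eq_dist
  exact hp ▸ Gxy_three_le_length hx hy p
end
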